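/- arXiv:0903.2864 — 2 statements merged into one kernel-verified Lean document; each statement's English description precedes it below -/
import Mathlib

section
/- Let k ≥ 10 and regard S_{2k} as the subgroup of S_{2k+1} fixing the point 2k+1. Let S_k×S_k ≤ S_{2k} be the subgroup of permutations mapping {1,…,k} to itself. Then: (i) for every subgroup G of S_k×S_k, the permutation character of S_{2k+1} on the cosets of G is not multiplicity-free; (ii) letting A_k≀S_2 denote the subgroup of S_{2k} consisting of those permutations g with g({1,…,k}) ∈ {{1,…,k},{k+1,…,2k}} such that, after composing g with the swap τ: i ↔ i+k if g({1,…,k}) = {k+1,…,2k}, the resulting block-preserving permutation restricts to even permutations of both {1,…,k} and {k+1,…,2k}, the permutation character of S_{2k+1} on the cosets of A_k≀S_2 is not multiplicity-free. -/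
/-- The permutation character of `G` on the cosets of `H` is multiplicity-free:
every irreducible complex representation of `G` has at most a one-dimensional
subspace of `H`-fixed vectors. -/
noncomputable def IsMultFree {G : Type} [Group G] (H : Subgroup G) : Prop :=
  ∀ V : FDRep ℂ G, CategoryTheory.Simple V →
    Module.finrank ℂ (Representation.invariants (V.ρ.comp H.subtype)) ≤ 1

/-- The subgroup of permutations of `α` mapping the set defined by `p` to itself. -/
def blockStab {α : Type*} (p : α → Prop) : Subgroup (Equiv.Perm α) where
  carrier := {g | ∀ i : α, p i ↔ p (g i)}
  one_mem' := by intro i; simp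
  mul_mem' := by
    intro a b ha hb i
    simpa [Equiv.Perm.mul_apply] using (hb i).trans (ha (b i))
  inv_mem' := by
    intro g hg i
    simpa using (hg (g⁻¹ i)).symm

/-- Restriction of a block-preserving permutation to the block `{i // p i}`. -/
def restrictBlock {α : Type*} (p : α → Prop) : blockStab p →* Equiv.Perm {i // p i} where
  toFun g := Equiv.Perm.subtypePerm g.1 (fun i => (g.2 i).symm)
  map_one' := by
    ext i
    simp [Equiv.Perm.subtypePerm]
  map_mul' a b := by
    ext i
    simp [Equiv.Perm.subtypePerm, Equiv.Perm.mul_apply]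

/-- Restriction of a block-preserving permutation to the complementary block `{i // ¬ p i}`. -/
def restrictCoblock {α : Type*} (p : α → Prop) : blockStab p →* Equiv.Perm {i // ¬ p i} where
  toFun g := Equiv.Perm.subtypePerm g.1 (fun i => not_congr (g.2 i).symm)
  map_one' := by
    ext i
    simp [Equiv.Perm.subtypePerm]
  map_mul' a b := by
    ext i
    simp [Equiv.Perm.subtypePerm, Equiv.Perm.mul_apply]

/-- The subgroup of permutations of `α` mapping the set defined by `p` to itself and
restricting to even permutations of both `{i // p i}` and its complement. -/
def evenEven {α : Type*} [Fintype α] [DecidableEq α] (p : α → Prop) [DecidablePred p] :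
    Subgroup (Equiv.Perm α) :=
  ((Equiv.Perm.sign.comp (restrictBlock p)).ker ⊓
      (Equiv.Perm.sign.comp (restrictCoblock p)).ker).map (blockStab p).subtype

/-- The subgroup of permutations preserving the partition of `α` into the fibres of a
colouring `c` (two points get mapped to the same fibre iff they lie in the same fibre). -/
def colorStab {α : Type*} {β : Sort*} (c : α → β) : Subgroup (Equiv.Perm α) where
  carrier := {g | ∀ i j : α, c i = c j ↔ c (g i) = c (g j)}
  one_mem' := by intro i j; simp
  mul_mem' := by
    intro a b ha hb i j
    simpa [Equiv.Perm.mul_apply] using (hb i j).trans (ha (b i) (b j))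
  inv_mem' := by
    intro g hg i j
    simpa using (hg (g⁻¹ i) (g⁻¹ j)).symm

/-- The natural embedding of the symmetric group on `α` into the symmetric group on
`Option α` (one extra point, which is fixed). -/
def optionHom (α : Type*) : Equiv.Perm α →* Equiv.Perm (Option α) where
  toFun e := e.optionCongr
  map_one' := by
    ext x
    cases x <;> simp
  map_mul' a b := by
    ext x
    cases x <;> simp [Equiv.Perm.mul_apply]

/-- The involution of `{1,…,2k}` interchanging `i` and `i + k` for `1 ≤ i ≤ k`. -/
def tauSwap (k : ℕ) : Equiv.Perm (Fin (2 * k)) :=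
  Function.Involutive.toPerm
    (fun i => if h : (i : ℕ) < k then ⟨(i : ℕ) + k, by have := i.isLt; omega⟩
      else ⟨(i : ℕ) - k, by have := i.isLt; omega⟩)
    (by
      intro i
      have hi := i.isLt
      dsimp only
      by_cases h : (i : ℕ) < k
      · rw [dif_pos h]
        rw [dif_neg (by simp)]
        exact Fin.ext (by simp)
      · rw [dif_neg h]
        rw [dif_pos (by simp; omega)]
        exact Fin.ext (by simp; omega))

open CategoryTheory in
theorem FDRep.simple_of_isIrreducible {G V : Type} [Group G] [Finite G] [AddCommGroup V]
    [Module ℂ V] [Module.Finite ℂ V] (ρ : Representation ℂ G V) [ρ.IsIrreducible] :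
    Simple (FDRep.of ρ) := by
  have : NeZero (Nat.card G : ℂ) := ⟨Nat.cast_ne_zero.mpr Nat.card_pos.ne'⟩
  rw [FDRep.simple_iff_end_is_rank_one,
    ← Representation.IsIrreducible.finrank_intertwiningMap_self ρ]
  exact ((Representation.linHom.invariantsEquivFDRepHom (FDRep.of ρ) (FDRep.of ρ)).symm ≪≫ₗ
    Representation.invariantsEquivIntertwiningMap ρ ρ).finrank_eq

theorem Representation.ofModule'_asAlgebraHom_apply {k G M : Type*} [CommSemiring k] [Monoid G]
    [AddCommMonoid M] [Module k M] [Module (MonoidAlgebra k G) M]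
    [IsScalarTower k (MonoidAlgebra k G) M] (r : MonoidAlgebra k G) (m : M) :
    (Representation.ofModule' (k := k) (G := G) M).asAlgebraHom r m = r • m := by
  simp [Representation.ofModule', Representation.asAlgebraHom_def]

theorem Representation.isIrreducible_ofModule' {k G : Type*} [Field k] [Monoid G] (M : Type*)
    [AddCommGroup M] [Module k M] [Module (MonoidAlgebra k G) M]
    [IsScalarTower k (MonoidAlgebra k G) M] [IsSimpleModule (MonoidAlgebra k G) M] :
    (Representation.ofModule' (k := k) (G := G) M).IsIrreducible := by
  rw [Representation.irreducible_iff_isSimpleModule_asModule]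
  let e : (Representation.ofModule' (k := k) (G := G) M).asModule ≃ₗ[MonoidAlgebra k G] M :=
    { (Representation.ofModule' (k := k) (G := G) M).asModuleEquiv.toAddEquiv with
      map_smul' := fun r m => (Representation.asModuleEquiv_map_smul _ r m).trans
        (Representation.ofModule'_asAlgebraHom_apply r _) }
  exact IsSimpleModule.congr e

open CategoryTheory in
/-- An element of the complex group algebra of a finite group that acts as zero on every
irreducible representation is zero. -/
theorem MonoidAlgebra.eq_zero_of_forall_simple {G : Type} [Group G] [Finite G]
    (r : MonoidAlgebra ℂ G)
    (h : ∀ V : FDRep ℂ G, Simple V → Representation.asAlgebraHom V.ρ r = 0) : r = 0 := by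
  have : NeZero (Nat.card G : ℂ) := ⟨Nat.cast_ne_zero.mpr Nat.card_pos.ne'⟩
  suffices ∀ x : MonoidAlgebra ℂ G, r * x = 0 by simpa using this 1
  intro x
  have hx : x ∈ sSup {S : Submodule (MonoidAlgebra ℂ G) (MonoidAlgebra ℂ G) |
      IsSimpleModule (MonoidAlgebra ℂ G) S} := by
    rw [IsSemisimpleModule.sSup_simples_eq_top]
    trivial
  rw [sSup_eq_iSup'] at hx
  refine Submodule.iSup_induction _ (motive := fun x => r * x = 0) hx ?_ (mul_zero r)
    fun a b ha hb => by rw [mul_add, ha, hb, add_zero]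
  rintro ⟨S, hS⟩ y hy
  have : IsSimpleModule (MonoidAlgebra ℂ G) S := hS
  have := Representation.isIrreducible_ofModule' (k := ℂ) (G := G) S
  have : Module.Finite ℂ S := Module.Finite.trans (MonoidAlgebra ℂ G) S
  have key := LinearMap.congr_fun (h _ (FDRep.simple_of_isIrreducible
    (Representation.ofModule' (k := ℂ) (G := G) S))) ⟨y, hy⟩
  exact congrArg Subtype.val ((Representation.ofModule'_asAlgebraHom_apply r _).symm.trans key)

/-- The vectors on which `K` acts, through `φ : K →* G`, by the quadratic character `ψ`. -/
def semiInvariants {G K V : Type*} [Group G] [Group K] [AddCommGroup V] [Module ℂ V]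
    (ρ : Representation ℂ G V) (φ : K →* G) (ψ : K →* ℤˣ) : Submodule ℂ V where
  carrier := {v | ∀ g, ρ (φ g) v = ((ψ g : ℤ) : ℂ) • v}
  zero_mem' g := by simp
  add_mem' hv hw g := by simp only [map_add, hv g, hw g, smul_add]
  smul_mem' c v hv g := by rw [map_smul, hv g, smul_comm]

theorem mem_semiInvariants {G K V : Type*} [Group G] [Group K] [AddCommGroup V] [Module ℂ V]
    {ρ : Representation ℂ G V} {φ : K →* G} {ψ : K →* ℤˣ} {v : V} :
    v ∈ semiInvariants ρ φ ψ ↔ ∀ g, ρ (φ g) v = ((ψ g : ℤ) : ℂ) • v := Iff.rfl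

theorem asAlgebraHom_mem_semiInvariants {G K V : Type*} [Group G] [Group K] [AddCommGroup V]
    [Module ℂ V] {ρ : Representation ℂ G V} {φ : K →* G} {ψ : K →* ℤˣ} {X : MonoidAlgebra ℂ G}
    (hX : ∀ g, Commute (MonoidAlgebra.of ℂ G (φ g)) X) {v : V}
    (hv : v ∈ semiInvariants ρ φ ψ) : ρ.asAlgebraHom X v ∈ semiInvariants ρ φ ψ := by
  intro g
  rw [← map_smul, ← hv g, ← Representation.asAlgebraHom_of, ← Module.End.mul_apply,
    ← Module.End.mul_apply, ← map_mul, ← map_mul, (hX g).eq]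

open CategoryTheory in
/-- If two elements centralizing `K` do not commute on a `ψ`-semi-invariant element of the group
algebra, then some irreducible representation has two independent `ψ`-semi-invariants. -/
theorem exists_simple_one_lt_finrank_semiInvariants {G K : Type} [Group G] [Finite G] [Group K]
    {φ : K →* G} {ψ : K →* ℤˣ} {X Y e : MonoidAlgebra ℂ G}
    (hX : ∀ g, Commute (MonoidAlgebra.of ℂ G (φ g)) X)
    (hY : ∀ g, Commute (MonoidAlgebra.of ℂ G (φ g)) Y)
    (he : ∀ g, MonoidAlgebra.of ℂ G (φ g) * e = ((ψ g : ℤ) : ℂ) • e)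
    (hne : X * Y * e ≠ Y * X * e) :
    ∃ V : FDRep ℂ G, Simple V ∧ 1 < Module.finrank ℂ (semiInvariants V.ρ φ ψ) := by
  by_contra! hle
  refine hne (sub_eq_zero.mp (MonoidAlgebra.eq_zero_of_forall_simple _ fun V hV => ?_))
  ext v
  have hev : Representation.asAlgebraHom V.ρ e v ∈ semiInvariants V.ρ φ ψ := by
    intro g
    rw [← Representation.asAlgebraHom_of, ← Module.End.mul_apply, ← map_mul, he g, map_smul,
      LinearMap.smul_apply]
  obtain ⟨u, hu⟩ := finrank_le_one_iff.mp (hle V hV)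
  have huX := asAlgebraHom_mem_semiInvariants hX u.2
  have huY := asAlgebraHom_mem_semiInvariants hY u.2
  obtain ⟨c, hc⟩ := hu ⟨_, hev⟩
  obtain ⟨x, hx⟩ := hu ⟨_, huX⟩
  obtain ⟨y, hy⟩ := hu ⟨_, huY⟩
  replace hc := congrArg Subtype.val hc
  replace hx := congrArg Subtype.val hx
  replace hy := congrArg Subtype.val hy
  simp only [Submodule.coe_smul] at hc hx hy
  simp only [map_sub, map_mul, LinearMap.sub_apply, Module.End.mul_apply, LinearMap.zero_apply]
  rw [← hc]
  simp only [map_smul, ← hx, ← hy]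
  rw [smul_comm x y, sub_self]

/-- The sum of the elements of `K` in the group algebra, weighted by `ψ`. -/
noncomputable def charSum {G K : Type*} [Group G] [Group K] [Fintype K] (φ : K →* G)
    (ψ : K →* ℤˣ) : MonoidAlgebra ℂ G :=
  ∑ h : K, MonoidAlgebra.single (φ h) ((ψ h : ℤ) : ℂ)

theorem of_mul_charSum {G K : Type*} [Group G] [Group K] [Fintype K] (φ : K →* G)
    (ψ : K →* ℤˣ) (g : K) :
    MonoidAlgebra.of ℂ G (φ g) * charSum φ ψ = ((ψ g : ℤ) : ℂ) • charSum φ ψ := by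
  simp only [charSum, Finset.mul_sum, Finset.smul_sum]
  refine Fintype.sum_equiv (Equiv.mulLeft g) _ _ fun h => ?_
  have : ((ψ g : ℤ) : ℂ) * ((ψ g : ℤ) : ℂ) = 1 := by
    rw [← Int.cast_mul, ← Units.val_mul, Int.units_mul_self]; simp
  simp [MonoidAlgebra.single_mul_single, ← mul_assoc, this]

section ExtraPoint

variable {α : Type}

theorem mem_blockStab_not {p : α → Prop} {g : Equiv.Perm α} (hg : g ∈ blockStab p) :
    g ∈ blockStab fun i => ¬ p i :=
  fun i => not_congr (hg i)

@[simp]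
theorem optionHom_apply_none (g : Equiv.Perm α) : optionHom α g none = none := rfl

@[simp]
theorem optionHom_apply_some (g : Equiv.Perm α) (i : α) : optionHom α g (some i) = some (g i) :=
  rfl

theorem swap_mul_swap_mul_optionHom_eq_iff [DecidableEq α] {p : α → Prop} {a b a₀ b₀ : α}
    (ha : p a) (hb : ¬ p b) (ha₀ : p a₀) (hb₀ : ¬ p b₀) (h : blockStab p) :
    Equiv.swap none (some a) * Equiv.swap none (some b) * optionHom α h =
      Equiv.swap none (some a₀) * Equiv.swap none (some b₀) ↔ a = a₀ ∧ b = b₀ ∧ h = 1 := by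
  have hne : ∀ {x y : α}, p x → ¬ p y → y ≠ x := by
    rintro x y hx hy rfl
    exact hy hx
  constructor
  · intro H
    have hbb : b = b₀ := by
      have := Equiv.congr_fun H none
      simpa [Equiv.swap_apply_of_ne_of_ne, hne ha hb, hne ha₀ hb₀] using this
    subst hbb
    have haa : a = a₀ := by
      obtain ⟨y, hy⟩ := (h : Equiv.Perm α).surjective b
      have hpy : ¬ p y := by rwa [h.2, hy]
      have := Equiv.congr_fun H (some y)
      by_cases hyb : y = b
      · have hb' : (h : Equiv.Perm α) b = b := hyb ▸ hy
        simpa [hyb, hb', Equiv.swap_apply_of_ne_of_ne, hne ha₀ hb₀] using this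
      · rw [Equiv.Perm.mul_apply, Equiv.Perm.mul_apply, Equiv.Perm.mul_apply,
          Equiv.swap_apply_of_ne_of_ne (x := some y) (by simp) (by simpa using hyb),
          Equiv.swap_apply_of_ne_of_ne (x := some y) (by simp) (by simpa using hne ha₀ hpy)] at this
        simp only [optionHom_apply_some, hy, Equiv.swap_apply_right, Equiv.swap_apply_left,
          Option.some.injEq] at this
        exact absurd (this ▸ ha) hpy
    subst haa
    refine ⟨rfl, rfl, ?_⟩
    have h1 : optionHom α h = 1 := by simpa using H
    ext i
    simpa using Equiv.congr_fun h1 (some i)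
  · rintro ⟨rfl, rfl, rfl⟩
    simp

theorem swap_mul_swap_mul_optionHom_ne [DecidableEq α] {a b a₀ b₀ : α}
    (hab : a ≠ b) (hab₀ : a₀ ≠ b₀) (ha : a ≠ b₀) (h : Equiv.Perm α) :
    Equiv.swap none (some b) * Equiv.swap none (some a) * optionHom α h ≠
      Equiv.swap none (some a₀) * Equiv.swap none (some b₀) := by
  intro H
  have := Equiv.congr_fun H none
  simp [Equiv.swap_apply_of_ne_of_ne, hab, hab₀.symm] at this
  exact ha this

variable [Fintype α] [DecidableEq α]

/-- The sum of the transpositions exchanging the extra point with a point satisfying `p`. -/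
noncomputable def swapSum (p : α → Prop) [DecidablePred p] :
    MonoidAlgebra ℂ (Equiv.Perm (Option α)) :=
  ∑ a with p a, MonoidAlgebra.of ℂ _ (Equiv.swap none (some a))

theorem commute_swapSum {p : α → Prop} [DecidablePred p] {g : Equiv.Perm α}
    (hg : g ∈ blockStab p) :
    Commute (MonoidAlgebra.of ℂ _ (optionHom α g)) (swapSum p) := by
  simp only [Commute, SemiconjBy, swapSum, Finset.mul_sum, Finset.sum_mul, ← map_mul]
  refine Finset.sum_equiv g (fun a => by simpa using hg a) fun a _ => ?_
  rw [Equiv.mul_swap_eq_swap_mul]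
  simp [optionHom]

theorem swapSum_mul_swapSum_mul_charSum {K : Type} [Group K] [Fintype K] (p q : α → Prop)
    [DecidablePred p] [DecidablePred q] (φ : K →* Equiv.Perm (Option α)) (ψ : K →* ℤˣ) :
    swapSum p * swapSum q * charSum φ ψ = ∑ a with p a, ∑ b with q b, ∑ h : K,
      MonoidAlgebra.single (Equiv.swap none (some a) * Equiv.swap none (some b) * φ h)
        ((ψ h : ℤ) : ℂ) := by
  rw [swapSum, swapSum, charSum, Finset.sum_mul_sum, Finset.sum_mul]
  refine Finset.sum_congr rfl fun a _ => ?_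
  rw [Finset.sum_mul]
  refine Finset.sum_congr rfl fun b _ => ?_
  rw [Finset.mul_sum]
  refine Finset.sum_congr rfl fun h _ => ?_
  rw [← map_mul, MonoidAlgebra.of_apply, MonoidAlgebra.single_mul_single, one_mul]

theorem swapSum_mul_swapSum_mul_charSum_ne {p : α → Prop} [DecidablePred p] {a₀ b₀ : α}
    (ha₀ : p a₀) (hb₀ : ¬ p b₀) [Fintype (blockStab p)] (ψ : blockStab p →* ℤˣ) :
    swapSum p * swapSum (fun i => ¬ p i) * charSum ((optionHom α).comp (blockStab p).subtype) ψ ≠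
      swapSum (fun i => ¬ p i) * swapSum p *
        charSum ((optionHom α).comp (blockStab p).subtype) ψ := by
  have hne : ∀ {x y : α}, p x → ¬ p y → x ≠ y := by
    rintro x y hx hy rfl
    exact hy hx
  intro H
  replace H := congrArg (fun x => x.coeff (Equiv.swap none (some a₀) * Equiv.swap none (some b₀))) H
  simp only [swapSum_mul_swapSum_mul_charSum, MonoidAlgebra.coeff_sum, Finsupp.finsetSum_apply,
    MonoidAlgebra.coeff_single, Finsupp.single_apply] at H
  rw [Finset.sum_eq_single a₀, Finset.sum_eq_single b₀, Finset.sum_eq_single 1] at H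
  · rw [if_pos (by simp), Finset.sum_eq_zero] at H
    · simp at H
    · intro b hb
      refine Finset.sum_eq_zero fun a ha => Finset.sum_eq_zero fun h _ => if_neg ?_
      simp only [Finset.mem_filter, Finset.mem_univ, true_and] at ha hb
      exact swap_mul_swap_mul_optionHom_ne (hne ha hb) (hne ha₀ hb₀) (hne ha hb₀) _
  · exact fun h _ hh => if_neg fun H' =>
      hh ((swap_mul_swap_mul_optionHom_eq_iff ha₀ hb₀ ha₀ hb₀ h).mp H').2.2
  · simp
  · intro b hb hbb
    simp only [Finset.mem_filter, Finset.mem_univ, true_and] at hb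
    exact Finset.sum_eq_zero fun h _ => if_neg fun H' =>
      hbb ((swap_mul_swap_mul_optionHom_eq_iff ha₀ hb ha₀ hb₀ h).mp H').2.1
  · simp [hb₀]
  · intro a ha haa
    refine Finset.sum_eq_zero fun b hb => Finset.sum_eq_zero fun h _ => if_neg fun H' => haa ?_
    simp only [Finset.mem_filter, Finset.mem_univ, true_and] at ha hb
    exact ((swap_mul_swap_mul_optionHom_eq_iff ha hb ha₀ hb₀ h).mp H').1
  · simp [ha₀]

open CategoryTheory in
/-- Every quadratic character of the stabilizer of two nonempty complementary blocks and of an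
extra point occurs at least twice in some irreducible representation. -/
theorem exists_simple_one_lt_finrank_semiInvariants_blockStab {p : α → Prop} {a₀ b₀ : α}
    (ha₀ : p a₀) (hb₀ : ¬ p b₀) (ψ : blockStab p →* ℤˣ) :
    ∃ V : FDRep ℂ (Equiv.Perm (Option α)), Simple V ∧
      1 < Module.finrank ℂ
        (semiInvariants V.ρ ((optionHom α).comp (blockStab p).subtype) ψ) := by
  classical
  have : Fintype (blockStab p) := Fintype.ofFinite _
  exact exists_simple_one_lt_finrank_semiInvariants
    (fun g => commute_swapSum g.2) (fun g => commute_swapSum (mem_blockStab_not g.2))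
    (of_mul_charSum _ ψ) (swapSum_mul_swapSum_mul_charSum_ne ha₀ hb₀ ψ)

theorem not_isMultFree_map_optionHom_of_le_blockStab {p : α → Prop} {a₀ b₀ : α}
    (ha₀ : p a₀) (hb₀ : ¬ p b₀) {G : Subgroup (Equiv.Perm α)} (hG : G ≤ blockStab p) :
    ¬ IsMultFree (G.map (optionHom α)) := by
  intro hfree
  obtain ⟨V, hV, hlt⟩ := exists_simple_one_lt_finrank_semiInvariants_blockStab ha₀ hb₀ 1
  refine (hlt.trans_le (Submodule.finrank_mono ?_)).not_ge (hfree V hV)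
  rintro v hv ⟨_, g, hg, rfl⟩
  simpa using hv ⟨g, hG hg⟩

theorem sign_restrictCoblock_eq_sign_restrictBlock {p : α → Prop} [DecidablePred p]
    {τ : Equiv.Perm α} (hτ : ∀ i, p i ↔ ¬ p (τ i)) {g g' : blockStab p}
    (h : ∀ i, (g' : Equiv.Perm α) (τ i) = τ ((g : Equiv.Perm α) i)) :
    Equiv.Perm.sign (restrictCoblock p g') = Equiv.Perm.sign (restrictBlock p g) :=
  (Equiv.Perm.sign_eq_sign_of_equiv (restrictBlock p g) (restrictCoblock p g')
    (τ.subtypeEquiv hτ) fun i => Subtype.ext (h i).symm).symm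

/-- A subgroup `H` of `Perm α` whose elements are, up to a block swap `τ`, even on
both blocks is not multiplicity-free in `Perm (Option α)`. -/
theorem not_isMultFree_map_optionHom_of_evenEven {p : α → Prop} [DecidablePred p]
    {τ : Equiv.Perm α} (hτ : ∀ i, p i ↔ ¬ p (τ i)) (hττ : τ * τ = 1) {a₀ a₁ : α} (ha₀ : p a₀)
    (ha₁ : p a₁) (ha : a₀ ≠ a₁) {H : Subgroup (Equiv.Perm α)}
    (hH : ∀ g ∈ H, g ∈ evenEven p ∨ τ * g ∈ evenEven p) :
    ¬ IsMultFree (H.map (optionHom α)) := by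
  intro hfree
  set ψ : blockStab p →* ℤˣ := Equiv.Perm.sign.comp (restrictCoblock p) with hψ
  obtain ⟨V, hV, hlt⟩ := exists_simple_one_lt_finrank_semiInvariants_blockStab ha₀
    ((hτ a₀).mp ha₀) ψ
  have : IsAddTorsionFree V := .of_isTorsionFree ℂ V
  set T : V →ₗ[ℂ] V := V.ρ (optionHom α τ) with hT
  have hTT : ∀ v, T (T v) = v := fun v => by
    rw [hT, ← Module.End.mul_apply, ← map_mul, ← map_mul, hττ]; simp
  have hτ' : ∀ i, τ (τ i) = i := fun i => by rw [← Equiv.Perm.mul_apply, hττ]; rfl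
  have conj_mem : ∀ g ∈ blockStab p, τ * g * τ ∈ blockStab p := fun g hg i => by
    rw [hτ, hg, hτ, not_not]
    rfl
  have semi_T : ∀ v ∈ semiInvariants V.ρ ((optionHom α).comp (blockStab p).subtype) ψ,
      ∀ g : blockStab p, V.ρ (optionHom α g) (T v) =
        ((Equiv.Perm.sign (restrictBlock p g) : ℤ) : ℂ) • T v := by
    intro v hv g
    have h1 := hv ⟨τ * g * τ, conj_mem g g.2⟩
    have h2 : ψ ⟨τ * g * τ, conj_mem g g.2⟩ = Equiv.Perm.sign (restrictBlock p g) :=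
      sign_restrictCoblock_eq_sign_restrictBlock hτ fun i => by simp [hτ']
    rw [h2] at h1
    have h3 := congrArg T h1
    rw [map_smul] at h3
    rw [← h3]
    simp only [MonoidHom.comp_apply, Subgroup.coe_subtype, map_mul, Module.End.mul_apply]
    exact (hTT _).symm
  have even_fix : ∀ v ∈ semiInvariants V.ρ ((optionHom α).comp (blockStab p).subtype) ψ,
      ∀ g ∈ evenEven p, V.ρ (optionHom α g) (v + T v) = v + T v := by
    rintro v hv _ ⟨g, ⟨hg, hg'⟩, rfl⟩
    have h1 := hv g
    have h2 := semi_T v hv g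
    rw [show ψ g = 1 from hg'] at h1
    rw [show Equiv.Perm.sign (restrictBlock p g) = 1 from hg] at h2
    rw [map_add]
    simpa using congrArg₂ (· + ·) h1 h2
  have mem : ∀ v ∈ semiInvariants V.ρ ((optionHom α).comp (blockStab p).subtype) ψ,
      ((LinearMap.id : V →ₗ[ℂ] V) + T) v ∈
        Representation.invariants (V.ρ.comp (H.map (optionHom α)).subtype) := by
    rintro v hv ⟨_, g, hg, rfl⟩
    change V.ρ (optionHom α g) (v + T v) = v + T v
    rcases hH g hg with h | h
    · exact even_fix v hv g h
    · have h1 := congrArg T (even_fix v hv _ h)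
      rw [map_mul, map_mul, Module.End.mul_apply, ← hT, hTT, map_add T, hTT, add_comm (T v)] at h1
      exact h1
  refine (hlt.trans_le (LinearMap.finrank_le_finrank_of_injective
    (f := ((LinearMap.id : V →ₗ[ℂ] V) + T).restrict mem) ?_)).not_ge (hfree V hV)
  rw [← LinearMap.ker_eq_bot, LinearMap.ker_eq_bot']
  rintro ⟨v, hv⟩ hv0
  replace hv0 : v + T v = 0 := congrArg Subtype.val hv0
  have hs : Equiv.swap a₀ a₁ ∈ blockStab p := fun i => by
    by_cases h0 : i = a₀
    · simp [h0, ha₀, ha₁]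
    by_cases h1 : i = a₁
    · simp [h1, ha₀, ha₁]
    rw [Equiv.swap_apply_of_ne_of_ne h0 h1]
  have hsC : ψ ⟨_, hs⟩ = 1 := by
    have : restrictCoblock p ⟨_, hs⟩ = 1 := by
      ext ⟨i, hi⟩
      exact Equiv.swap_apply_of_ne_of_ne (x := i) (fun h => hi (h ▸ ha₀)) (fun h => hi (h ▸ ha₁))
    simp [hψ, this]
  have hsB : Equiv.Perm.sign (restrictBlock p ⟨_, hs⟩) = -1 := by
    rw [← Equiv.Perm.sign_swap ha]
    refine Equiv.Perm.sign_subtypePerm _ (fun i => (hs i).symm) fun i hi => ?_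
    by_contra hpi
    exact hi (Equiv.swap_apply_of_ne_of_ne (fun h => hpi (h ▸ ha₀)) (fun h => hpi (h ▸ ha₁)))
  have h1 := hv ⟨_, hs⟩
  have h2 := semi_T v hv ⟨_, hs⟩
  rw [hsC] at h1
  rw [hsB, eq_neg_of_add_eq_zero_right hv0, map_neg] at h2
  replace h1 : V.ρ (optionHom α (Equiv.swap a₀ a₁)) v = v := by simpa using h1
  rw [h1] at h2
  replace h2 : -v = v := by simpa using h2
  exact Subtype.ext (neg_eq_self.mp h2)

end ExtraPoint

theorem stmt8 (k : ℕ) (hk : 10 ≤ k) :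
    (∀ G : Subgroup (Equiv.Perm (Fin (2 * k))),
      G ≤ blockStab (fun i : Fin (2 * k) => (i : ℕ) < k) →
      ¬ IsMultFree (G.map (optionHom (Fin (2 * k))))) ∧
    (∀ H : Subgroup (Equiv.Perm (Fin (2 * k))),
      -- `H = A_k ≀ S_2`: the permutations preserving or swapping the two blocks which,
      -- after composing with the swap `τ` when the blocks are interchanged, restrict to
      -- even permutations of both blocks
      (∀ g : Equiv.Perm (Fin (2 * k)), g ∈ H ↔
        g ∈ colorStab (fun i : Fin (2 * k) => ((i : ℕ) < k : Prop)) ∧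
          (if ∀ i : Fin (2 * k), (i : ℕ) < k → ((g i : ℕ) < k) then g else tauSwap k * g) ∈
            evenEven (fun i : Fin (2 * k) => (i : ℕ) < k)) →
      ¬ IsMultFree (H.map (optionHom (Fin (2 * k))))) := by
  have h0 : 0 < 2 * k := by omega
  have h1 : 1 < 2 * k := by omega
  have hk' : k < 2 * k := by omega
  constructor
  · intro G hG
    exact not_isMultFree_map_optionHom_of_le_blockStab (a₀ := ⟨0, h0⟩) (b₀ := ⟨k, hk'⟩)
      (by simp; omega) (by simp) hG
  · intro H hH
    refine not_isMultFree_map_optionHom_of_evenEven (p := fun i : Fin (2 * k) => (i : ℕ) < k)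
      (τ := tauSwap k) (a₀ := ⟨0, h0⟩) (a₁ := ⟨1, h1⟩) (fun i => ?_) ?_ (by simp; omega)
      (by simp; omega) (by simp) fun g hg => ?_
    · change _ ↔ ¬ ((if h : (i : ℕ) < k then _ else _ : Fin (2 * k)) : ℕ) < k
      split_ifs <;> simp <;> omega
    · exact Equiv.ext (tauSwap k).left_inv
    · have := ((hH g).mp hg).2
      split_ifs at this
      · exact Or.inl this
      · exact Or.inr this
end

section
/- Let Ω_6 = ℙ¹(F_5) be the projective line over the field with 5 elements (the projectivization of the 2-dimensional vector space F_5², a 6-element set), and let G_6 ≤ Sym(Ω_6) be the image of the natural action homomorphism GL_2(F_5) → Sym(Ω_6) (so G_6 ≅ PGL(2,5) of order 120). For every n ≥ 6, identify S_n with the symmetric group on the disjoint union Ω = Ω_6 ⊔ {7,…,n}, and let G_6 × S_{n−6} be the subgroup of permutations of Ω mapping Ω_6 to itself whose restriction to Ω_6 lies in G_6. Then the permutation character of S_n on the cosets of G_6 × S_{n−6} is multiplicity-free. -/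
instance : Fact (Nat.Prime 5) := ⟨by norm_num⟩

/-- The permutation of the projective space `ℙ K V` induced by a linear automorphism of `V`. -/
noncomputable def projPerm {K V : Type*} [Field K] [AddCommGroup V] [Module K V]
    (e : V ≃ₗ[K] V) : Equiv.Perm (Projectivization K V) where
  toFun := Projectivization.map (e : V →ₗ[K] V) e.injective
  invFun := Projectivization.map (e.symm : V →ₗ[K] V) e.symm.injective
  left_inv x := by
    induction x using Projectivization.ind with
    | h v hv => simp [Projectivization.map_mk]
  right_inv x := by
    induction x using Projectivization.ind with
    | h v hv => simp [Projectivization.map_mk]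

/-- The action of the group of linear automorphisms of `V` on `ℙ K V`, as a homomorphism
to the symmetric group of `ℙ K V`. -/
noncomputable def projAutHom (K V : Type*) [Field K] [AddCommGroup V] [Module K V] :
    (V ≃ₗ[K] V) →* Equiv.Perm (Projectivization K V) where
  toFun := projPerm
  map_one' := by
    ext x
    induction x using Projectivization.ind with
    | h v hv => simp [projPerm, Projectivization.map_mk]
  map_mul' e f := by
    ext x
    induction x using Projectivization.ind with
    | h v hv => simp [projPerm, Projectivization.map_mk]; rfl

/-- The natural action homomorphism `GL₂(F₅) → Sym(ℙ¹(F₅))`. -/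
noncomputable def glProjHom :
    Matrix.GeneralLinearGroup (Fin 2) (ZMod 5) →*
      Equiv.Perm (Projectivization (ZMod 5) (Fin 2 → ZMod 5)) :=
  (projAutHom (ZMod 5) (Fin 2 → ZMod 5)).comp
    (((LinearMap.GeneralLinearGroup.generalLinearEquiv (ZMod 5)
        (Fin 2 → ZMod 5)).toMonoidHom).comp
      (Matrix.GeneralLinearGroup.toLin :
        Matrix.GeneralLinearGroup (Fin 2) (ZMod 5) ≃*
          LinearMap.GeneralLinearGroup (ZMod 5) (Fin 2 → ZMod 5)).toMonoidHom)

/-- `G₆ ≅ PGL(2,5)`: the image of `GL₂(F₅)` in the symmetric group on the projective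
line `ℙ¹(F₅)`. -/
noncomputable def pgl25 : Subgroup (Equiv.Perm (Projectivization (ZMod 5) (Fin 2 → ZMod 5))) :=
  glProjHom.range

open CategoryTheory in
/-- A nonzero invariant subspace of a simple representation is everything. -/
theorem FDRep.eq_top_of_simple {k G : Type} [Field k] [Monoid G] (V : FDRep k G) [Simple V]
    (W : Submodule k V) (hW : ∀ g, ∀ w ∈ W, V.ρ g w ∈ W) (hne : W ≠ ⊥) : W = ⊤ := by
  let σ : G →* (W →ₗ[k] W) :=
    { toFun := fun g => (V.ρ g).restrict (hW g)
      map_one' := by ext; simp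
      map_mul' := fun g h => by ext; simp }
  let i : FDRep.of σ ⟶ V :=
    { hom := FGModuleCat.ofHom W.subtype
      comm := fun g => by ext w; rfl }
  have hi : Function.Injective ((forget (FDRep k G)).map i) := fun a b h => Subtype.ext h
  have : Mono i := (forget (FDRep k G)).mono_of_mono_map ((mono_iff_injective _).mpr hi)
  have h0 : i ≠ 0 := by
    intro h
    apply hne
    rw [Submodule.eq_bot_iff]
    intro w hw
    have : (i.hom.hom.hom) ⟨w, hw⟩ = (0 : FDRep.of σ ⟶ V).hom.hom.hom ⟨w, hw⟩ := by rw [h]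
    exact this
  have : IsIso i := isIso_of_mono_of_nonzero h0
  have hs : Function.Surjective ((forget (FDRep k G)).map i) :=
    ((isIso_iff_bijective ((forget (FDRep k G)).map i)).mp inferInstance).2
  rw [Submodule.eq_top_iff']
  intro v
  obtain ⟨w, hw⟩ := hs v
  have : (w : W).1 = v := hw
  exact this ▸ (w : W).2

section Gelfand

variable {k G V : Type*} [Field k] [Group G] [AddCommGroup V] [Module k V]

/-- The unnormalised averaging operator over a finite subgroup. -/
noncomputable def Representation.sumOver (ρ : Representation k G V) (H : Subgroup G) [Fintype H] :
    Module.End k V := ∑ h : H, ρ h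

variable (ρ : Representation k G V) (H : Subgroup G) [Fintype H]

namespace Representation

theorem sumOver_mul_left {h : G} (hh : h ∈ H) : ρ h * ρ.sumOver H = ρ.sumOver H := by
  simp only [sumOver, Finset.mul_sum, ← map_mul]
  exact Fintype.sum_equiv (Equiv.mulLeft (⟨h, hh⟩ : H)) _ _ fun _ => rfl

theorem sumOver_mul_right {h : G} (hh : h ∈ H) : ρ.sumOver H * ρ h = ρ.sumOver H := by
  simp only [sumOver, Finset.sum_mul, ← map_mul]
  exact Fintype.sum_equiv (Equiv.mulRight (⟨h, hh⟩ : H)) _ _ fun _ => rfl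

theorem sumOver_apply_mem_invariants (v : V) :
    ρ.sumOver H v ∈ invariants (MonoidHom.comp ρ H.subtype) := fun h =>
  LinearMap.congr_fun (sumOver_mul_left ρ H h.2) v

theorem sumOver_apply_of_mem_invariants {v : V}
    (hv : v ∈ invariants (MonoidHom.comp ρ H.subtype)) :
    ρ.sumOver H v = Fintype.card H • v := by
  have : ∀ h : H, ρ h v = v := hv
  simp [sumOver, LinearMap.sum_apply, this]

variable {H}

theorem sumOver_conj_inv (hH : ∀ g : G, ∃ a ∈ H, ∃ b ∈ H, g⁻¹ = a * g * b) (g : G) :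
    ρ.sumOver H * ρ g⁻¹ * ρ.sumOver H = ρ.sumOver H * ρ g * ρ.sumOver H := by
  obtain ⟨a, ha, b, hb, h⟩ := hH g
  rw [h, map_mul, map_mul, ← mul_assoc, ← mul_assoc, sumOver_mul_right ρ H ha, mul_assoc,
    sumOver_mul_left ρ H hb]

/-- Gelfand's lemma: the Hecke operators commute. -/
theorem sumOver_conj_comm (hH : ∀ g : G, ∃ a ∈ H, ∃ b ∈ H, g⁻¹ = a * g * b) (g l : G) :
    ρ.sumOver H * ρ g * ρ.sumOver H * ρ l * ρ.sumOver H =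
      ρ.sumOver H * ρ l * ρ.sumOver H * ρ g * ρ.sumOver H := by
  set e := ρ.sumOver H with he
  have key : ∀ x y : G, e * ρ x * e * ρ y * e = ∑ h : H, e * ρ (x * h * y) * e := fun x y => by
    calc e * ρ x * e * ρ y * e = e * ρ x * (∑ h : H, ρ h) * ρ y * e := rfl
      _ = _ := by simp only [Finset.mul_sum, Finset.sum_mul, map_mul, mul_assoc]
  have hinv : ∀ x, e * ρ x⁻¹ * e = e * ρ x * e := sumOver_conj_inv ρ hH
  calc e * ρ g * e * ρ l * e = ∑ h : H, e * ρ (g * h * l) * e := key g l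
    _ = ∑ h : H, e * ρ (l⁻¹ * h * g⁻¹) * e := by
      refine Fintype.sum_equiv (Equiv.inv H) _ _ fun h => ?_
      rw [← hinv]
      simp [mul_assoc]
    _ = e * ρ l⁻¹ * e * ρ g⁻¹ * e := (key _ _).symm
    _ = e * ρ l * e * ρ g * e := by
      rw [hinv l, mul_assoc (e * ρ l), mul_assoc (e * ρ l), mul_assoc (e * ρ l), mul_assoc (e * ρ l),
        hinv g]

/-- Gelfand's trick: if every double coset of `H` is closed under inversion, then the invariants
of `H` in an irreducible representation are at most one-dimensional. -/
theorem finrank_invariants_le_one [IsAlgClosed k] [CharZero k] [FiniteDimensional k V]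
    (hirr : ∀ W : Submodule k V, (∀ g, ∀ w ∈ W, ρ g w ∈ W) → W ≠ ⊥ → W = ⊤)
    (hH : ∀ g : G, ∃ a ∈ H, ∃ b ∈ H, g⁻¹ = a * g * b) :
    Module.finrank k (invariants (MonoidHom.comp ρ H.subtype)) ≤ 1 := by
  set e := ρ.sumOver H with he
  set I := invariants (MonoidHom.comp ρ H.subtype) with hI
  have hcard : (Fintype.card H : k) ≠ 0 := Nat.cast_ne_zero.mpr Fintype.card_ne_zero
  have heI : ∀ v, e v ∈ I := sumOver_apply_mem_invariants ρ H
  have hev : ∀ v ∈ I, e v = (Fintype.card H : k) • v := fun v hv => by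
    rw [Nat.cast_smul_eq_nsmul]
    exact sumOver_apply_of_mem_invariants ρ H hv
  have hstable : ∀ W : Submodule k V, W ≠ ⊥ → W ≤ I → (∀ g, ∀ w ∈ W, e (ρ g w) ∈ W) → I ≤ W := by
    intro W hne hWI hW v hv
    have htop : Submodule.span k {u | ∃ g, ∃ w ∈ W, u = ρ g w} = ⊤ := by
      refine hirr _ (fun g u hu => ?_) fun h => hne ?_
      · refine Submodule.span_induction (p := fun u _ => ρ g u ∈ Submodule.span k _) ?_ ?_ ?_ ?_ hu
        · rintro _ ⟨l, w, hw, rfl⟩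
          exact Submodule.subset_span ⟨g * l, w, hw, by simp⟩
        · simp
        · intro x y _ _ hx hy
          rw [map_add]
          exact Submodule.add_mem _ hx hy
        · intro c x _ hx
          rw [map_smul]
          exact Submodule.smul_mem _ _ hx
      · rw [eq_bot_iff, ← h]
        exact fun w hw => Submodule.subset_span ⟨1, w, hw, by simp⟩
    have hle : Submodule.span k {u | ∃ g, ∃ w ∈ W, u = ρ g w} ≤ W.comap e := by
      rw [Submodule.span_le]
      rintro _ ⟨g, w, hw, rfl⟩
      exact hW g w hw
    have hv' : e v ∈ W := hle (htop ▸ Submodule.mem_top)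
    rw [hev v hv] at hv'
    exact (W.smul_mem_iff hcard).mp hv'
  by_cases hbot : I = ⊥
  · rw [hbot]
    simp
  have hnt : Nontrivial I := Submodule.nontrivial_iff_ne_bot.mpr hbot
  have hscalar : ∀ g, ∃ c : k, ∀ v ∈ I, e (ρ g v) = c • v := by
    intro g
    let T : Module.End k I := (e * ρ g).restrict fun v _ => heI _
    obtain ⟨c, hc⟩ := Module.End.exists_eigenvalue T
    obtain ⟨x, hx⟩ := hc.exists_hasEigenvector
    refine ⟨c, fun v hv => ?_⟩
    let W : Submodule k V := I ⊓ LinearMap.ker (e * ρ g - c • 1)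
    have hmem : ∀ w, w ∈ W ↔ w ∈ I ∧ e (ρ g w) = c • w := fun w => by
      simp [W, sub_eq_zero]
    refine ((hmem v).mp (hstable W ?_ inf_le_left ?_ hv)).2
    · rw [Submodule.ne_bot_iff]
      exact ⟨x, (hmem _).mpr ⟨x.2, congrArg Subtype.val hx.apply_eq_smul⟩,
        fun h => hx.2 (Subtype.ext h)⟩
    · intro l w hw
      obtain ⟨hwI, hw⟩ := (hmem w).mp hw
      refine (hmem _).mpr ⟨heI _, ?_⟩
      have h := LinearMap.congr_fun (sumOver_conj_comm ρ hH g l) w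
      simp only [Module.End.mul_apply, ← he, hev w hwI, hw, map_smul] at h
      exact smul_right_injective V hcard h
  obtain ⟨v, hv⟩ := exists_ne (0 : I)
  refine finrank_le_one v fun w => ?_
  have hle := hstable (Submodule.span k {(v : V)}) (by simpa using hv) (by simp) fun g u hu => by
    obtain ⟨c, hc⟩ := hscalar g
    rw [hc u ((by simp : Submodule.span k {(v : V)} ≤ I) hu)]
    exact Submodule.smul_mem _ _ hu
  obtain ⟨c, hc⟩ := Submodule.mem_span_singleton.mp (hle w.2)
  exact ⟨c, Subtype.ext hc⟩

end Representation
end Gelfand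

theorem Set.InjOn.exists_perm_eqOn {α : Type*} [Finite α] {f : α → α} {s : Set α}
    (hf : s.InjOn f) : ∃ σ : Equiv.Perm α, s.EqOn σ f := by
  classical
  cases nonempty_fintype α
  obtain ⟨g, hg⟩ := Set.MapsTo.exists_equiv_extend_of_card_eq (t := Finset.univ)
    Finset.card_univ.symm (by simp) hf
  exact ⟨g.trans (Equiv.subtypeUnivEquiv Finset.mem_univ), hg⟩

namespace Equiv.Perm

variable {α β : Type*} [Finite α] [Finite β]

theorem exists_eq_sumCongr_one {w : Perm (α ⊕ β)} (hw : ∀ y, w (.inl y) = .inl y) :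
    ∃ b : Perm β, w = sumCongr 1 b := by
  obtain ⟨⟨s, b⟩, rfl⟩ := mem_sumCongrHom_range_of_perm_mapsTo_inl (σ := w) (by
    rintro _ ⟨y, rfl⟩
    exact ⟨y, (hw y).symm⟩)
  have hs : s = 1 := by
    ext y
    simpa using hw y
  exact ⟨b, by simp [hs]⟩

theorem exists_eq_sumCongr_mul_mul (u v : Perm (α ⊕ β))
    (h : ∀ y, (∃ z, u (.inl y) = .inl z ∧ v (.inl y) = .inl z) ∨
      ∃ p q, u (.inl y) = .inr p ∧ v (.inl y) = .inr q) :
    ∃ a b : Perm β, v = sumCongr 1 a * u * sumCongr 1 b := by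
  let f : β → β := fun p => (v (u⁻¹ (.inr p))).elim (fun _ => p) id
  have hf : ∀ y p q, u (.inl y) = .inr p → v (.inl y) = .inr q → f p = q := by
    intro y p q hp hq
    simp [f, ← hp, hq]
  have hinj : Set.InjOn f {p | ∃ y, u (.inl y) = .inr p} := by
    rintro p ⟨y, hy⟩ p' ⟨y', hy'⟩ hpp
    obtain ⟨z, hz, -⟩ | ⟨r, q, hr, hq⟩ := h y
    · simp [hz] at hy
    obtain ⟨z, hz, -⟩ | ⟨r', q', hr', hq'⟩ := h y'
    · simp [hz] at hy'
    rw [hf y p q hy hq, hf y' p' q' hy' hq'] at hpp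
    have : y = y' := Sum.inl_injective (v.injective (by rw [hq, hq', hpp]))
    subst this
    exact Sum.inr_injective (hy.symm.trans hy')
  obtain ⟨a, ha⟩ := hinj.exists_perm_eqOn
  have hav : ∀ y, (sumCongr 1 a * u : Perm (α ⊕ β)) (.inl y) = v (.inl y) := by
    intro y
    obtain ⟨z, hz, hz'⟩ | ⟨p, q, hp, hq⟩ := h y
    · simp [hz, hz']
    · simp [hp, hq, ha ⟨y, hp⟩, hf y p q hp hq]
  obtain ⟨b, hb⟩ := exists_eq_sumCongr_one (w := (sumCongr 1 a * u)⁻¹ * v) fun y => by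
    rw [mul_apply, ← hav, inv_eq_iff_eq]
  exact ⟨a, b, by rw [← hb]; group⟩

/-- If on every set `D`, every permutation `x` of `α` becomes an involution with values in `D` after
left multiplication by some element of `K`, then every double coset of `K × Perm β` is closed
under inversion. -/
theorem exists_inv_eq_mul_mul_of_prod (K : Subgroup (Perm α))
    (hK : ∀ (x : Perm α) (D : Set α), ∃ k ∈ K, ∀ d ∈ D, k (x d) ∈ D ∧ k (x (k (x d))) = d)
    (g : Perm (α ⊕ β)) :
    ∃ a ∈ (K.prod ⊤).map (sumCongrHom α β), ∃ b ∈ (K.prod ⊤).map (sumCongrHom α β),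
      g⁻¹ = a * g * b := by
  let D : Set α := {d | ∃ z, g (.inl d) = .inl z}
  let f : α → α := fun d => (g (.inl d)).elim id fun _ => d
  have hf : ∀ d ∈ D, g (.inl d) = .inl (f d) := by
    rintro d ⟨z, hz⟩
    simp [f, hz]
  obtain ⟨x, hx⟩ := Set.InjOn.exists_perm_eqOn (f := f) (s := D) fun d hd d' hd' h =>
    Sum.inl_injective (g.injective (by rw [hf d hd, hf d' hd', h]))
  have hgx : ∀ d ∈ D, g (.inl d) = .inl (x d) := fun d hd => by rw [hx hd, hf d hd]
  obtain ⟨k, hk, hkx⟩ := hK x D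
  have hmem : ∀ a : Perm β, sumCongr k a ∈ (K.prod ⊤).map (sumCongrHom α β) := fun a =>
    ⟨(k, a), ⟨hk, trivial⟩, rfl⟩
  obtain ⟨a, b, hab⟩ := exists_eq_sumCongr_mul_mul (sumCongr k 1 * g * sumCongr k 1) g⁻¹ fun y => by
    by_cases hy : ∃ d ∈ D, x d = y
    · obtain ⟨d, hd, rfl⟩ := hy
      left
      refine ⟨d, ?_, ?_⟩
      · simp [hgx _ (hkx d hd).1, (hkx d hd).2]
      · rw [inv_eq_iff_eq, hgx d hd]
    · right
      have hky : k y ∉ D := fun hD => hy ⟨_, (hkx _ hD).1, k.injective (hkx _ hD).2⟩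
      cases hp : g (.inl (k y)) with
      | inl z => exact absurd ⟨z, hp⟩ hky
      | inr p =>
        cases hq : g⁻¹ (.inl y) with
        | inl d =>
          have hd : g (.inl d) = .inl y := (inv_eq_iff_eq.mp hq).symm
          exact absurd ⟨d, ⟨y, hd⟩, Sum.inl_injective ((hgx d ⟨y, hd⟩).symm.trans hd)⟩ hy
        | inr q => exact ⟨p, q, by simp [hp], rfl⟩
  refine ⟨_, hmem a, _, hmem b, hab.trans ?_⟩
  have h1 : sumCongr k a = sumCongr 1 a * sumCongr k (1 : Perm β) := by simp
  have h2 : sumCongr k b = sumCongr k (1 : Perm β) * sumCongr 1 b := by simp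
  rw [h1, h2]
  group

end Equiv.Perm

/-- Homogeneous coordinates for `∞, 0, 1, 2, 3, 4`, in this order. -/
def projLineVec : Fin 6 → Fin 2 → ZMod 5 :=
  ![![1, 0], ![0, 1], ![1, 1], ![2, 1], ![3, 1], ![4, 1]]

theorem projLineVec_ne_zero : ∀ i, projLineVec i ≠ 0 := by decide

theorem bijective_mk_projLineVec : Function.Bijective fun i =>
    Projectivization.mk (ZMod 5) (projLineVec i) (projLineVec_ne_zero i) := by
  constructor
  · intro i j h
    obtain ⟨a, ha⟩ := (Projectivization.mk_eq_mk_iff' _ _ _ _ _).mp h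
    have : ∀ i j, ∀ a : ZMod 5, a • projLineVec j = projLineVec i → i = j := by decide
    exact this i j a ha
  · intro x
    induction x using Projectivization.ind with
    | h v hv =>
      have : ∀ v : Fin 2 → ZMod 5, v ≠ 0 → ∃ i, ∃ a : ZMod 5, a • v = projLineVec i := by decide
      obtain ⟨i, a, ha⟩ := this v hv
      exact ⟨i, (Projectivization.mk_eq_mk_iff' _ _ _ _ _).mpr ⟨a, ha⟩⟩

/-- The enumeration `∞, 0, 1, 2, 3, 4` of `ℙ¹(F₅)`. -/
noncomputable def finSixEquivProjLine :
    Fin 6 ≃ Projectivization (ZMod 5) (Fin 2 → ZMod 5) :=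
  Equiv.ofBijective _ bijective_mk_projLineVec

theorem finSixEquivProjLine_apply (i : Fin 6) : finSixEquivProjLine i =
    Projectivization.mk (ZMod 5) (projLineVec i) (projLineVec_ne_zero i) := rfl

/-- `PGL(2, 5)` as a group of permutations of `Fin 6`. -/
noncomputable def pgl25Fin : Subgroup (Equiv.Perm (Fin 6)) :=
  pgl25.comap finSixEquivProjLine.permCongrHom.toMonoidHom

theorem mem_pgl25Fin_of_matrix (τ : Equiv.Perm (Fin 6)) (M : Matrix (Fin 2) (Fin 2) (ZMod 5))
    (hM : M.det ≠ 0)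
    (h : ∀ i, ∃ a : ZMod 5, a • M.mulVec (projLineVec i) = projLineVec (τ i)) :
    τ ∈ pgl25Fin := by
  refine ⟨Matrix.GeneralLinearGroup.mkOfDetNeZero M hM, ?_⟩
  ext x
  obtain ⟨i, rfl⟩ := finSixEquivProjLine.surjective x
  obtain ⟨a, ha⟩ := h i
  have h1 : finSixEquivProjLine.permCongrHom τ (finSixEquivProjLine i) =
      finSixEquivProjLine (τ i) := by simp
  refine Eq.trans ?_ h1.symm
  rw [finSixEquivProjLine_apply, finSixEquivProjLine_apply]
  exact ((Projectivization.mk_eq_mk_iff' _ _ _ _ _).mpr ⟨a, ha⟩).symm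

section

open Equiv

theorem exists_mem_pgl25Fin_apply_eq {p q r : Fin 6} (hpq : p ≠ q) (hpr : p ≠ r) (hqr : q ≠ r) :
    ∃ h ∈ pgl25Fin, h p = 0 ∧ h q = 1 ∧ h r = 2 := by
  have ht : c[1, 2, 3, 4, 5] ∈ pgl25Fin :=
    mem_pgl25Fin_of_matrix _ !![1, 1; 0, 1] (by decide) (by decide)
  have hd : c[2, 3, 5, 4] ∈ pgl25Fin :=
    mem_pgl25Fin_of_matrix _ !![1, 0; 0, 3] (by decide) (by decide)
  have hw : swap 0 1 * swap 3 4 ∈ pgl25Fin :=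
    mem_pgl25Fin_of_matrix _ !![0, 1; 1, 0] (by decide) (by decide)
  obtain ⟨h₀, hh₀, hp₀⟩ : ∃ h ∈ pgl25Fin, h p = 0 := by
    have : ∀ p : Fin 6, ∃ i : Fin 5, ∃ j : Fin 2,
      ((swap 0 1 * swap 3 4) ^ j.1 * c[1, 2, 3, 4, 5] ^ i.1 : Perm (Fin 6)) p = 0 := by decide
    obtain ⟨i, j, hij⟩ := this p
    exact ⟨_, mul_mem (pow_mem hw _) (pow_mem ht _), hij⟩
  obtain ⟨h₁, hh₁, hp₁, hq₁⟩ : ∃ h ∈ pgl25Fin, h 0 = 0 ∧ h (h₀ q) = 1 := by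
    have : ∀ q : Fin 6, q ≠ 0 → ∃ i : Fin 5,
      (c[1, 2, 3, 4, 5] ^ i.1 : Perm (Fin 6)) 0 = 0 ∧
      (c[1, 2, 3, 4, 5] ^ i.1 : Perm (Fin 6)) q = 1 := by decide
    obtain ⟨i, hi⟩ := this (h₀ q) (hp₀ ▸ h₀.injective.ne hpq.symm)
    exact ⟨_, pow_mem ht _, hi⟩
  obtain ⟨h₂, hh₂, hp₂, hq₂, hr₂⟩ : ∃ h ∈ pgl25Fin, h 0 = 0 ∧ h 1 = 1 ∧ h (h₁ (h₀ r)) = 2 := by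
    have : ∀ r : Fin 6, r ≠ 0 → r ≠ 1 → ∃ i : Fin 4,
      (c[2, 3, 5, 4] ^ i.1 : Perm (Fin 6)) 0 = 0 ∧
      (c[2, 3, 5, 4] ^ i.1 : Perm (Fin 6)) 1 = 1 ∧
      (c[2, 3, 5, 4] ^ i.1 : Perm (Fin 6)) r = 2 := by decide
    obtain ⟨i, hi⟩ := this (h₁ (h₀ r))
      (fun h => hpr (h₀.injective (h₁.injective (by rw [hp₀, hp₁, h]))))
      (fun h => hqr (h₀.injective (h₁.injective (by rw [hq₁, h]))))
    exact ⟨_, pow_mem hd _, hi⟩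
  exact ⟨h₂ * h₁ * h₀, mul_mem (mul_mem hh₂ hh₁) hh₀,
    by simp [hp₀, hp₁, hp₂], by simp [hq₁, hq₂], by simp [hr₂]⟩

theorem eq_of_fix_zero_one_two : ∀ σ : Perm (Fin 6), σ 0 = 0 → σ 1 = 1 → σ 2 = 2 →
    σ = 1 ∨ σ = swap 4 5 ∨ σ = swap 3 4 ∨ σ = swap 3 5 ∨ σ = c[3, 4, 5] ∨ σ = c[3, 5, 4] := by
  decide +kernel

theorem exists_mul_swap_mem_pgl25Fin (σ : Perm (Fin 6)) (h0 : σ 0 = 0) (h1 : σ 1 = 1)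
    (h2 : σ 2 = 2) (D : Finset (Fin 6)) (hD : 4 ≤ D.card) :
    ∃ a ∈ D, ∃ b ∈ D, σ * swap a b ∈ pgl25Fin := by
  obtain rfl | rfl | rfl | rfl | rfl | rfl := eq_of_fix_zero_one_two σ h0 h1 h2
  · obtain ⟨a, ha⟩ := Finset.card_pos.mp (by lia : 0 < D.card)
    exact ⟨a, ha, a, ha, by rw [swap_self, one_mul]; exact one_mem _⟩
  · have : ∀ D : Finset (Fin 6), 4 ≤ D.card →
      0 ∈ D ∧ 2 ∈ D ∨ 1 ∈ D ∧ 3 ∈ D ∨ 4 ∈ D ∧ 5 ∈ D := by decide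
    obtain ⟨ha, hb⟩ | ⟨ha, hb⟩ | ⟨ha, hb⟩ := this D hD
    · exact ⟨_, ha, _, hb, mem_pgl25Fin_of_matrix _ !![1, 0; 1, 4] (by decide) (by decide)⟩
    · exact ⟨_, ha, _, hb, mem_pgl25Fin_of_matrix _ !![1, 3; 0, 4] (by decide) (by decide)⟩
    · exact ⟨_, ha, _, hb, mem_pgl25Fin_of_matrix _ !![1, 0; 0, 1] (by decide) (by decide)⟩
  · have : ∀ D : Finset (Fin 6), 4 ≤ D.card →
      0 ∈ D ∧ 1 ∈ D ∨ 2 ∈ D ∧ 5 ∈ D ∨ 3 ∈ D ∧ 4 ∈ D := by decide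
    obtain ⟨ha, hb⟩ | ⟨ha, hb⟩ | ⟨ha, hb⟩ := this D hD
    · exact ⟨_, ha, _, hb, mem_pgl25Fin_of_matrix _ !![0, 1; 1, 0] (by decide) (by decide)⟩
    · exact ⟨_, ha, _, hb, mem_pgl25Fin_of_matrix _ !![1, 0; 0, 4] (by decide) (by decide)⟩
    · exact ⟨_, ha, _, hb, mem_pgl25Fin_of_matrix _ !![1, 0; 0, 1] (by decide) (by decide)⟩
  · have : ∀ D : Finset (Fin 6), 4 ≤ D.card →
      0 ∈ D ∧ 4 ∈ D ∨ 1 ∈ D ∧ 2 ∈ D ∨ 3 ∈ D ∧ 5 ∈ D := by decide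
    obtain ⟨ha, hb⟩ | ⟨ha, hb⟩ | ⟨ha, hb⟩ := this D hD
    · exact ⟨_, ha, _, hb, mem_pgl25Fin_of_matrix _ !![1, 0; 2, 4] (by decide) (by decide)⟩
    · exact ⟨_, ha, _, hb, mem_pgl25Fin_of_matrix _ !![1, 4; 0, 4] (by decide) (by decide)⟩
    · exact ⟨_, ha, _, hb, mem_pgl25Fin_of_matrix _ !![1, 0; 0, 1] (by decide) (by decide)⟩
  · have : ∀ D : Finset (Fin 6), 4 ≤ D.card →
      0 ∈ D ∧ 5 ∈ D ∨ 1 ∈ D ∧ 4 ∈ D ∨ 2 ∈ D ∧ 3 ∈ D := by decide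
    obtain ⟨ha, hb⟩ | ⟨ha, hb⟩ | ⟨ha, hb⟩ := this D hD
    · exact ⟨_, ha, _, hb, mem_pgl25Fin_of_matrix _ !![1, 0; 3, 3] (by decide) (by decide)⟩
    · exact ⟨_, ha, _, hb, mem_pgl25Fin_of_matrix _ !![1, 2; 0, 3] (by decide) (by decide)⟩
    · exact ⟨_, ha, _, hb, mem_pgl25Fin_of_matrix _ !![1, 0; 0, 2] (by decide) (by decide)⟩
  · have : ∀ D : Finset (Fin 6), 4 ≤ D.card →
      0 ∈ D ∧ 3 ∈ D ∨ 1 ∈ D ∧ 5 ∈ D ∨ 2 ∈ D ∧ 4 ∈ D := by decide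
    obtain ⟨ha, hb⟩ | ⟨ha, hb⟩ | ⟨ha, hb⟩ := this D hD
    · exact ⟨_, ha, _, hb, mem_pgl25Fin_of_matrix _ !![1, 0; 4, 2] (by decide) (by decide)⟩
    · exact ⟨_, ha, _, hb, mem_pgl25Fin_of_matrix _ !![1, 1; 0, 2] (by decide) (by decide)⟩
    · exact ⟨_, ha, _, hb, mem_pgl25Fin_of_matrix _ !![1, 0; 0, 3] (by decide) (by decide)⟩

theorem exists_mem_pgl25Fin_involutive_on (x : Perm (Fin 6)) (D : Finset (Fin 6)) :
    ∃ k ∈ pgl25Fin, ∀ d ∈ D, k (x d) ∈ D ∧ k (x (k (x d))) = d := by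
  obtain hD | hD := le_or_gt D.card 3
  · obtain ⟨D', hDD', hD'⟩ := Finset.exists_superset_card_eq hD (by simp)
    obtain ⟨p, q, r, hpq, hpr, hqr, rfl⟩ := Finset.card_eq_three.mp hD'
    obtain ⟨h, hh, hp, hq, hr⟩ := exists_mem_pgl25Fin_apply_eq hpq hpr hqr
    obtain ⟨l, hl, lp, lq, lr⟩ := exists_mem_pgl25Fin_apply_eq (x.injective.ne hpq)
      (x.injective.ne hpr) (x.injective.ne hqr)
    have hfix : ∀ d ∈ D, (h⁻¹ * l) (x d) = d := by
      intro d hd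
      rw [Perm.mul_apply, Perm.inv_eq_iff_eq]
      have := hDD' hd
      simp only [Finset.mem_insert, Finset.mem_singleton] at this
      obtain rfl | rfl | rfl := this
      · rw [hp, lp]
      · rw [hq, lq]
      · rw [hr, lr]
    refine ⟨h⁻¹ * l, mul_mem (inv_mem hh) hl, fun d hd => ?_⟩
    rw [hfix d hd, hfix d hd]
    exact ⟨hd, rfl⟩
  · obtain ⟨l, hl, l0, l1, l2⟩ := exists_mem_pgl25Fin_apply_eq
      (x.injective.ne (by decide : (0 : Fin 6) ≠ 1)) (x.injective.ne (by decide : (0 : Fin 6) ≠ 2))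
      (x.injective.ne (by decide : (1 : Fin 6) ≠ 2))
    obtain ⟨a, ha, b, hb, hab⟩ := exists_mul_swap_mem_pgl25Fin (l * x) l0 l1 l2 D hD
    refine ⟨(l * x * swap a b)⁻¹ * l, mul_mem (inv_mem hab) hl, fun d hd => ?_⟩
    have hswap : ∀ d, ((l * x * swap a b)⁻¹ * l) (x d) = swap a b d := by
      intro d
      rw [Perm.mul_apply, Perm.inv_eq_iff_eq]
      simp
    rw [hswap, hswap, swap_apply_self]
    refine ⟨?_, rfl⟩
    rw [swap_apply_def]
    split_ifs <;> assumption

theorem exists_mem_pgl25_involutive_on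
    (x : Perm (Projectivization (ZMod 5) (Fin 2 → ZMod 5)))
    (D : Set (Projectivization (ZMod 5) (Fin 2 → ZMod 5))) :
    ∃ k ∈ pgl25, ∀ d ∈ D, k (x d) ∈ D ∧ k (x (k (x d))) = d := by
  classical
  let e := finSixEquivProjLine
  obtain ⟨k, hk, hkx⟩ := exists_mem_pgl25Fin_involutive_on (e.symm.permCongr x)
    (Finset.univ.filter fun i => e i ∈ D)
  refine ⟨e.permCongr k, hk, fun d hd => ?_⟩
  have := hkx (e.symm d) (by simpa using hd)
  simp only [permCongr_apply, symm_symm, apply_symm_apply, Finset.mem_filter, Finset.mem_univ,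
    true_and] at this ⊢
  exact ⟨this.1, by rw [this.2, apply_symm_apply]⟩

end

theorem stmt16 (m : ℕ) :
    IsMultFree ((pgl25.prod (⊤ : Subgroup (Equiv.Perm (Fin m)))).map
      (Equiv.Perm.sumCongrHom (Projectivization (ZMod 5) (Fin 2 → ZMod 5)) (Fin m))) := by
  intro V hV
  classical
  cases nonempty_fintype (Equiv.Perm (Projectivization (ZMod 5) (Fin 2 → ZMod 5) ⊕ Fin m))
  exact Representation.finrank_invariants_le_one V.ρ
    (FDRep.eq_top_of_simple V)
    (Equiv.Perm.exists_inv_eq_mul_mul_of_prod pgl25 exists_mem_pgl25_involutive_on)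
end
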